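/- arXiv:2605.29061 — 3 statements merged into one kernel-verified Lean document; each statement's English description precedes it below -/
import Mathlib

section
/- For every m ≥ 1 and every probability vector p₁,…,p_m (nonnegative, summing to 1), there exist binary codewords w₁,…,w_m ∈ List Bool that form a prefix-free family (no wᵢ is a prefix of wⱼ for i ≠ j), that are strictly increasing in lexicographic order (w₁ < w₂ < … < w_m lexicographically, so the code corresponds to an ordered (alphabetic) binary tree whose leaves appear in order), and whose expected length satisfies ∑ⱼ pⱼ·|wⱼ| ≤ H(p) + 2, where H(p) = ∑ⱼ pⱼ·log₂(1/pⱼ). -/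
open Finset

/-- The dyadic rational in `[0, 1)` whose binary expansion is the given word. -/
noncomputable def binaryValue : List Bool → ℝ
  | [] => 0
  | b :: w => ((if b then 1 else 0) + binaryValue w) / 2

lemma binaryValue_nonneg (w : List Bool) : 0 ≤ binaryValue w := by
  induction w with
  | nil => simp [binaryValue]
  | cons b w ih => cases b <;> simp only [binaryValue] <;> positivity

lemma binaryValue_add_le_one (w : List Bool) :
    binaryValue w + (1 / 2 : ℝ) ^ w.length ≤ 1 := by
  induction w with
  | nil => simp [binaryValue]
  | cons b w ih =>
    rw [List.length_cons, pow_succ]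
    cases b <;> simp only [binaryValue, if_true, Bool.false_eq_true, if_false] <;> linarith

/-- Words whose dyadic intervals are disjoint and ordered are prefix-incomparable and
lexicographically ordered. -/
lemma lex_and_not_prefix_of_binaryValue_add_le (u v : List Bool)
    (h : binaryValue u + (1 / 2 : ℝ) ^ u.length ≤ binaryValue v) :
    List.Lex (· < ·) u v ∧ ¬ u <+: v ∧ ¬ v <+: u := by
  induction u generalizing v with
  | nil =>
    have h₁ := binaryValue_add_le_one v
    have h₂ : (0 : ℝ) < (1 / 2) ^ v.length := by positivity
    simp only [binaryValue, List.length_nil, pow_zero] at h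
    linarith
  | cons a u ih =>
    have hu : (0 : ℝ) < (1 / 2) ^ u.length := by positivity
    have hu₀ := binaryValue_nonneg u
    rw [List.length_cons, pow_succ] at h
    cases v with
    | nil =>
      cases a <;> simp only [binaryValue, if_true, Bool.false_eq_true, if_false] at h <;> linarith
    | cons b v =>
      have hv := binaryValue_add_le_one v
      have hv₀ : (0 : ℝ) < (1 / 2) ^ v.length := by positivity
      cases a <;> cases b <;>
        simp only [binaryValue, if_true, Bool.false_eq_true, if_false] at h
      · obtain ⟨h₁, h₂, h₃⟩ := ih v (by linarith)
        exact ⟨List.Lex.cons h₁, by simpa using h₂, by simpa using h₃⟩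
      · exact ⟨List.Lex.rel (by decide), by simp, by simp⟩
      · linarith
      · obtain ⟨h₁, h₂, h₃⟩ := ih v (by linarith)
        exact ⟨List.Lex.cons h₁, by simpa using h₂, by simpa using h₃⟩

lemma exists_binaryValue_approx (n : ℕ) (x : ℝ) (hx₀ : 0 ≤ x) (hx₁ : x < 1) :
    ∃ w : List Bool, w.length = n ∧ binaryValue w ≤ x ∧ x < binaryValue w + (1 / 2 : ℝ) ^ n := by
  induction n generalizing x with
  | zero => exact ⟨[], by simp [binaryValue, hx₀, hx₁]⟩
  | succ n ih =>
    rcases lt_or_ge x (1 / 2) with hx | hx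
    · obtain ⟨w, hw, h₁, h₂⟩ := ih (2 * x) (by linarith) (by linarith)
      refine ⟨false :: w, by simp [hw], ?_, ?_⟩ <;>
        simp only [binaryValue, Bool.false_eq_true, if_false, pow_succ] <;> linarith
    · obtain ⟨w, hw, h₁, h₂⟩ := ih (2 * x - 1) (by linarith) (by linarith)
      refine ⟨true :: w, by simp [hw], ?_, ?_⟩ <;>
        simp only [binaryValue, if_true, pow_succ] <;> linarith

/-- A Kraft-type condition sufficient for the existence of an alphabetic code with
prescribed lengths. -/
lemma exists_alphabetic_code_of_kraft {m : ℕ} (l : Fin m → ℕ)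
    (hl : ∑ j, 2 * (1 / 2 : ℝ) ^ l j ≤ 1) :
    ∃ w : Fin m → List Bool, (∀ j, (w j).length = l j) ∧
      (∀ i j : Fin m, i ≠ j → ¬ (w i <+: w j)) ∧
      (∀ i j : Fin m, i < j → List.Lex (· < ·) (w i) (w j)) := by
  set a : Fin m → ℝ := fun j => 2 * (1 / 2 : ℝ) ^ l j with ha
  have ha₀ (j) : 0 < a j := by simp only [ha]; positivity
  have hIic (j) : ∑ i ∈ Iio j, a i + a j = ∑ i ∈ Iic j, a i := by
    rw [← Iio_insert, sum_insert (by simp), add_comm]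
  have hIic_le (j) : ∑ i ∈ Iic j, a i ≤ 1 :=
    (sum_le_sum_of_subset_of_nonneg (subset_univ _) fun i _ _ => (ha₀ i).le).trans hl
  have hex (j) : ∃ w : List Bool, w.length = l j ∧ ∑ i ∈ Iio j, a i ≤ binaryValue w ∧
      binaryValue w + (1 / 2 : ℝ) ^ l j ≤ ∑ i ∈ Iic j, a i := by
    have h₀ : 0 ≤ ∑ i ∈ Iio j, a i := sum_nonneg fun i _ => (ha₀ i).le
    have h₁ : a j = 2 * (1 / 2 : ℝ) ^ l j := rfl
    have h₂ := ha₀ j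
    have h₃ := hIic j
    have h₄ := hIic_le j
    obtain ⟨w, hw, hw₁, hw₂⟩ := exists_binaryValue_approx (l j)
      (∑ i ∈ Iio j, a i + (1 / 2 : ℝ) ^ l j) (by linarith) (by linarith)
    exact ⟨w, hw, by linarith, by linarith⟩
  choose w hw hlow hupp using hex
  have key (i j) (hij : i < j) :
      List.Lex (· < ·) (w i) (w j) ∧ ¬ w i <+: w j ∧ ¬ w j <+: w i := by
    apply lex_and_not_prefix_of_binaryValue_add_le
    rw [hw]
    refine (hupp i).trans (le_trans ?_ (hlow j))
    exact sum_le_sum_of_subset_of_nonneg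
      (fun k hk => mem_Iio.2 ((mem_Iic.1 hk).trans_lt hij)) fun k _ _ => (ha₀ k).le
  refine ⟨w, hw, fun i j hij => ?_, fun i j hij => (key i j hij).1⟩
  rcases lt_or_gt_of_ne hij with h | h
  · exact (key i j h).2.1
  · exact (key j i h).2.2

lemma half_pow_floor_logb_add_one_lt {q : ℝ} (hq : 0 < q) :
    (1 / 2 : ℝ) ^ (⌊Real.logb 2 (1 / q)⌋₊ + 1) < q := by
  have h := Nat.lt_floor_add_one (Real.logb 2 (1 / q))
  rw [Real.logb_lt_iff_lt_rpow one_lt_two (by positivity)] at h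
  rw [one_div_pow, one_div_lt (by positivity) hq]
  exact_mod_cast h

/-- **Mehlhorn's nearly optimal alphabetic routing.**
For every probability vector `p` on `Fin m` there is a prefix-free family of
binary codewords `w j : List Bool`, strictly increasing in lexicographic order
(so it corresponds to an ordered (alphabetic) binary tree whose leaves appear
in index order), whose expected length is at most the entropy `H(p)` plus `2`. -/
theorem alphabetic_code_entropy_plus_two
    (m : ℕ) (hm : 1 ≤ m)
    (p : Fin m → ℝ) (hp : ∀ j, 0 ≤ p j) (hsum : ∑ j, p j = 1) :
    ∃ w : Fin m → List Bool,
      (∀ i j : Fin m, i ≠ j → ¬ (w i <+: w j)) ∧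
      (∀ i j : Fin m, i < j → List.Lex (· < ·) (w i) (w j)) ∧
      ∑ j, p j * ((w j).length : ℝ) ≤ (∑ j, p j * Real.logb 2 (1 / p j)) + 2 := by
  set l₀ : Fin m → ℕ := fun j => ⌊Real.logb 2 (1 / p j)⌋₊ + 2 with hl₀
  set b : Fin m → ℝ := fun j => if 0 < p j then 2 * (1 / 2 : ℝ) ^ l₀ j else 0 with hb
  have hlt (j) (hj : 0 < p j) : b j < p j := by
    have h := half_pow_floor_logb_add_one_lt hj
    simp only [hb, hl₀, if_pos hj, pow_succ] at h ⊢
    linarith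
  have hle (j) : b j ≤ p j := by
    by_cases hj : 0 < p j
    · exact (hlt j hj).le
    · simpa [hb, hj] using hp j
  have hpos : ∃ j, 0 < p j := by
    by_contra! h
    linarith [sum_nonpos fun j (_ : j ∈ univ) => h j]
  have hb₁ : ∑ j, b j < 1 := by
    obtain ⟨j, hj⟩ := hpos
    exact (sum_lt_sum (fun i _ => hle i) ⟨j, mem_univ j, hlt j hj⟩).trans_eq hsum
  have hm₀ : (0 : ℝ) < m := by exact_mod_cast hm
  set ε : ℝ := (1 - ∑ j, b j) / m with hε
  have hε₀ : 0 < ε := div_pos (by linarith) hm₀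
  obtain ⟨n, hn⟩ := exists_pow_lt_of_lt_one (half_pos hε₀) (one_half_lt_one (α := ℝ))
  obtain ⟨w, hw, hprefix, hlex⟩ :=
    exists_alphabetic_code_of_kraft (fun j => if 0 < p j then l₀ j else n) <| by
      calc ∑ j, 2 * (1 / 2 : ℝ) ^ (if 0 < p j then l₀ j else n)
          ≤ ∑ j, (b j + ε) := by
            refine sum_le_sum fun j _ => ?_
            by_cases hj : 0 < p j
            · simp only [hb, if_pos hj]; linarith
            · simp only [hb, if_neg hj]; linarith
        _ = 1 := by
            rw [sum_add_distrib, sum_const, card_univ, Fintype.card_fin, nsmul_eq_mul, hε,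
              mul_div_cancel₀ _ hm₀.ne']
            ring
  refine ⟨w, hprefix, hlex, ?_⟩
  calc ∑ j, p j * ((w j).length : ℝ)
      ≤ ∑ j, (p j * Real.logb 2 (1 / p j) + p j * 2) := by
        refine sum_le_sum fun j _ => ?_
        rcases (hp j).eq_or_lt with hj | hj
        · simp [← hj]
        · rw [hw, if_pos hj, ← mul_add]
          refine mul_le_mul_of_nonneg_left ?_ (hp j)
          have h₁ : p j ≤ 1 := hsum ▸ single_le_sum (fun i _ => hp i) (mem_univ j)
          have h₂ := Nat.floor_le
            (Real.logb_nonneg one_lt_two ((one_le_div hj).2 h₁))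
          simp only [hl₀]
          push_cast
          linarith
    _ = (∑ j, p j * Real.logb 2 (1 / p j)) + 2 := by
        rw [sum_add_distrib, ← sum_mul, hsum, one_mul]
end

section
/- Let A and Y be jointly distributed random variables each taking finitely many values, and for every value y with P(Y=y) > 0 let Δ_y ≥ 0 be an integer (the certified radius encoded by transcript y). Fix constants c₀, c₁ ∈ (0,1] and suppose the (c₀,c₁)-rank-spread condition holds: for every such y there is a set R_y of at least c₀·(1+Δ_y) values of A, each with P(A=a | Y=y) ≥ c₁/(1+Δ_y). Then there exist constants c > 0 and C ≥ 0 depending only on c₀ and c₁ such that for every family of per-transcript binary prefix codes d_y (satisfying Kraft's inequality ∑_a 2^(−d_y(a)) ≤ 1 for each y), the expected repair codelength satisfies E[d_Y(A)] ≥ c·E[log₂(1+Δ_Y)] − C. In particular, if Δ_y = Δ for all y, the expected repair cost is at least c·log₂(1+Δ) − C. -/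
open Finset

/-- The tangent-line bound for the logarithm, in the form used for Kraft sums. -/
theorem logb_two_add_le_natCast {x : ℝ} (hx : 0 < x) (n : ℕ) :
    Real.logb 2 x + (1 - x * (2 : ℝ) ^ (-(n : ℝ))) / Real.log 2 ≤ n := by
  have hlog : 0 < Real.log 2 := Real.log_pos one_lt_two
  have hpow : (0 : ℝ) < (2 : ℝ) ^ (-(n : ℝ)) := by positivity
  have h := Real.log_le_sub_one_of_pos (mul_pos hx hpow)
  rw [Real.log_mul hx.ne' hpow.ne', Real.log_rpow two_pos] at h
  rw [Real.logb, ← add_div, div_le_iff₀ hlog]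
  linarith

/-- The lengths of a binary code on at least `x` words satisfying Kraft's inequality
average at least `logb 2 x`. -/
theorem card_mul_logb_le_sum_of_kraft {α : Type*} (S : Finset α) (d : α → ℕ) {x : ℝ}
    (hx : 0 < x) (hxS : x ≤ (S.card : ℝ)) (hkraft : ∑ a ∈ S, (2 : ℝ) ^ (-(d a : ℝ)) ≤ 1) :
    (S.card : ℝ) * Real.logb 2 x ≤ ∑ a ∈ S, (d a : ℝ) := by
  have hlog : 0 < Real.log 2 := Real.log_pos one_lt_two
  have h := Finset.sum_le_sum fun a (_ : a ∈ S) => logb_two_add_le_natCast hx (d a)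
  rw [Finset.sum_add_distrib, ← Finset.sum_div, Finset.sum_sub_distrib, ← Finset.mul_sum,
    Finset.sum_const, Finset.sum_const, nsmul_eq_mul, nsmul_eq_mul, mul_one] at h
  have h2 : 0 ≤ ((S.card : ℝ) - x * ∑ a ∈ S, (2 : ℝ) ^ (-(d a : ℝ))) / Real.log 2 :=
    div_nonneg (by nlinarith) hlog.le
  linarith

/-- If at least `c₀ * N` letters each carry a fraction at least `c₁ / N` of the total weight,
then every code satisfying Kraft's inequality has mean length at least
`c₀ * c₁ * logb 2 (c₀ * N)`. -/
theorem mul_logb_le_sum_mul_of_rank_spread {α : Type*} [Fintype α] {c₀ c₁ N : ℝ}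
    (hc₀ : 0 < c₀) (hc₁ : 0 < c₁) (hN : 0 < N) (w : α → ℝ) (hw : ∀ a, 0 ≤ w a)
    (hpos : 0 < ∑ a, w a) (R : Set α) (hR : c₀ * N ≤ (R.ncard : ℝ))
    (hRw : ∀ a ∈ R, c₁ / N ≤ w a / ∑ a', w a') (d : α → ℕ)
    (hkraft : ∑ a, (2 : ℝ) ^ (-(d a : ℝ)) ≤ 1) :
    c₀ * c₁ * ((∑ a, w a) * Real.logb 2 (c₀ * N)) ≤ ∑ a, w a * (d a : ℝ) := by
  classical
  set W := ∑ a, w a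
  have hnonneg : ∀ a, 0 ≤ w a * (d a : ℝ) := fun a => mul_nonneg (hw a) (Nat.cast_nonneg _)
  rcases le_or_gt (Real.logb 2 (c₀ * N)) 0 with ht | ht
  · refine le_trans ?_ (Finset.sum_nonneg fun a _ => hnonneg a)
    exact mul_nonpos_of_nonneg_of_nonpos (by positivity)
      (mul_nonpos_of_nonneg_of_nonpos hpos.le ht)
  · set S := R.toFinset
    rw [Set.ncard_eq_toFinset_card'] at hR
    have hS : (S.card : ℝ) * Real.logb 2 (c₀ * N) ≤ ∑ a ∈ S, (d a : ℝ) :=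
      card_mul_logb_le_sum_of_kraft S d (mul_pos hc₀ hN) hR <|
        (Finset.sum_le_univ_sum_of_nonneg fun a => by positivity).trans hkraft
    calc c₀ * c₁ * (W * Real.logb 2 (c₀ * N))
        = c₁ / N * W * (c₀ * N * Real.logb 2 (c₀ * N)) := by field_simp
      _ ≤ c₁ / N * W * ∑ a ∈ S, (d a : ℝ) := by
          gcongr
          exact (mul_le_mul_of_nonneg_right hR ht.le).trans hS
      _ = ∑ a ∈ S, c₁ / N * W * (d a : ℝ) := Finset.mul_sum ..
      _ ≤ ∑ a ∈ S, w a * (d a : ℝ) := by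
          refine Finset.sum_le_sum fun a ha => ?_
          gcongr
          exact (le_div_iff₀ hpos).1 (hRw a (Set.mem_toFinset.1 ha))
      _ ≤ ∑ a, w a * (d a : ℝ) := Finset.sum_le_univ_sum_of_nonneg hnonneg

/-- **Rank-spread expected repair lower bound (transcript-dependent radii).**
Given a joint pmf `μ a y` of answer `A` and transcript `Y` on finite types and
certified radii `Δ y` per transcript, under the `(c₀,c₁)`-rank-spread condition
there are constants `c > 0`, `C ≥ 0` depending only on `c₀, c₁` such that every
family of per-transcript binary prefix codes `d y` (Kraft: `∑ a, 2^(-d y a) ≤ 1`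
for positive-probability `y`) has expected repair codelength at least
`c · E[log₂(1+Δ_Y)] − C`; in particular, for a constant radius `Δ₀`,
at least `c · log₂(1+Δ₀) − C`. -/
theorem rank_spread_expected_repair
    (c₀ c₁ : ℝ) (hc₀ : 0 < c₀) (hc₀' : c₀ ≤ 1) (hc₁ : 0 < c₁) (hc₁' : c₁ ≤ 1) :
    ∃ c : ℝ, 0 < c ∧ ∃ C : ℝ, 0 ≤ C ∧
      ∀ (𝓐 𝓨 : Type) [Fintype 𝓐] [Fintype 𝓨] (μ : 𝓐 → 𝓨 → ℝ),
        (∀ a y, 0 ≤ μ a y) → (∑ a, ∑ y, μ a y = 1) →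
        ∀ Δ : 𝓨 → ℕ,
          -- (c₀,c₁)-rank-spread with transcript-dependent radii
          (∀ y, 0 < ∑ a, μ a y →
            ∃ R : Set 𝓐, c₀ * (1 + (Δ y : ℝ)) ≤ (R.ncard : ℝ) ∧
              ∀ a ∈ R, c₁ / (1 + (Δ y : ℝ)) ≤ μ a y / ∑ a', μ a' y) →
          ∀ d : 𝓨 → 𝓐 → ℕ,
            (∀ y, 0 < ∑ a, μ a y → ∑ a, (2 : ℝ) ^ (-(d y a : ℝ)) ≤ 1) →
            (c * (∑ y, (∑ a, μ a y) * Real.logb 2 (1 + (Δ y : ℝ))) - C ≤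
              ∑ y, ∑ a, μ a y * (d y a : ℝ)) ∧
            (∀ Δ₀ : ℕ, (∀ y, Δ y = Δ₀) →
              c * Real.logb 2 (1 + (Δ₀ : ℝ)) - C ≤
                ∑ y, ∑ a, μ a y * (d y a : ℝ)) := by
  refine ⟨c₀ * c₁, mul_pos hc₀ hc₁, -(c₀ * c₁ * Real.logb 2 c₀), ?_, ?_⟩
  · exact neg_nonneg.2 (mul_nonpos_of_nonneg_of_nonpos (mul_pos hc₀ hc₁).le
      (Real.logb_nonpos one_lt_two hc₀.le hc₀'))
  intro 𝓐 𝓨 _ _ μ hμ hsum Δ hspread d hkraft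
  have htotal : ∑ y, ∑ a, μ a y = 1 := by rw [Finset.sum_comm, hsum]
  have hbound : ∀ y, c₀ * c₁ * ((∑ a, μ a y) * (Real.logb 2 c₀ +
      Real.logb 2 (1 + (Δ y : ℝ)))) ≤ ∑ a, μ a y * (d y a : ℝ) := by
    intro y
    have hN : (0 : ℝ) < 1 + (Δ y : ℝ) := by positivity
    rcases (Finset.sum_nonneg fun a (_ : a ∈ Finset.univ) => hμ a y).eq_or_lt with h0 | hpos
    · rw [← h0, zero_mul, mul_zero]
      exact Finset.sum_nonneg fun a _ => mul_nonneg (hμ a y) (Nat.cast_nonneg _)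
    · obtain ⟨R, hR, hRw⟩ := hspread y hpos
      rw [← Real.logb_mul hc₀.ne' hN.ne']
      exact mul_logb_le_sum_mul_of_rank_spread hc₀ hc₁ hN (fun a => μ a y) (fun a => hμ a y)
        hpos R hR hRw (d y) (hkraft y hpos)
  have hmain : c₀ * c₁ * (∑ y, (∑ a, μ a y) * Real.logb 2 (1 + (Δ y : ℝ))) -
      -(c₀ * c₁ * Real.logb 2 c₀) ≤ ∑ y, ∑ a, μ a y * (d y a : ℝ) := by
    have h := Finset.sum_le_sum fun y (_ : y ∈ Finset.univ) => hbound y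
    simp only [mul_add] at h
    rw [Finset.sum_add_distrib, ← Finset.mul_sum, ← Finset.mul_sum, ← Finset.sum_mul,
      htotal, one_mul] at h
    linarith
  refine ⟨hmain, fun Δ₀ hΔ => ?_⟩
  simpa only [hΔ, ← Finset.sum_mul, htotal, one_mul] using hmain
end

section
/- Fix constants a, b > 0. There exist constants c > 0 and C ≥ 0 depending only on a, b with the following property. Let m ≥ 2, let every leaf have equal mass pⱼ = 1/m, exponent α = 1, hardness κⱼ ≥ κ for some κ > 0, diameters Rⱼ ∈ ℕ large enough that the full-repair cap is not binding at the optimum, and costs Cⱼ satisfying the (a,b,1)-sandwich with Cⱼ(Rⱼ)=0. Then the optimal fixed-partition cost Opt = min over integer radius tuples with ∑ⱼ Cⱼ(Δⱼ) ≤ B of H(p) + ∑ⱼ pⱼ·log₂(1+Δⱼ) satisfies Opt ≥ c·( log₂ m + log₂⁺( κ·m/(B+m) ) ) − C. In particular, if B + m = o(κ·m) as the instance grows, then Opt → ∞, so constant expected query time is impossible in this regime. -/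
open Finset

/-- A feasible radius tuple has average logarithmic radius at least that of the threshold
`κ * m / (B + m)`, up to an additive constant: each leaf either pays for its hardness or is
repaired out to its full diameter `R j`. -/
lemma logb_threshold_le_average_logb_radius
    {a : ℝ} (ha : 0 < a) {m : ℕ} (hm : 0 < m) {κ : ℝ} (hκ : 0 < κ)
    {κv : Fin m → ℝ} (hκv : ∀ j, κ ≤ κv j)
    {R : Fin m → ℕ} {B : ℕ} {Cst : Fin m → ℕ → ℕ}
    (hlower : ∀ (j : Fin m) (Δ : ℕ), Δ < R j →
      a * (1 + κv j * (1 + (Δ : ℝ))⁻¹) ≤ 1 + (Cst j Δ : ℝ))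
    (hcap : ∀ j, κv j * (m : ℝ) / ((B : ℝ) + m) ≤ (R j : ℝ))
    {Δv : Fin m → ℕ} (hΔ : ∀ j, Δv j ≤ R j)
    (hbudget : (∑ j, (Cst j (Δv j) : ℝ)) ≤ (B : ℝ)) :
    Real.logb 2 (κ * (m : ℝ) / ((B : ℝ) + m)) ≤
      ∑ j, (1 / (m : ℝ)) * Real.logb 2 (1 + (Δv j : ℝ)) + (1 / a + 1) / Real.log 2 := by
  have hm' : (0 : ℝ) < m := by exact_mod_cast hm
  have hBm : (0 : ℝ) < (B : ℝ) + m := by positivity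
  have hlog : 0 < Real.log 2 := Real.log_pos (by norm_num)
  set X := κ * (m : ℝ) / ((B : ℝ) + m) with hX
  have hXpos : 0 < X := by positivity
  have leaf_ratio (j : Fin m) :
      X / (1 + (Δv j : ℝ)) ≤ 1 + m / ((B : ℝ) + m) * ((1 + (Cst j (Δv j) : ℝ)) / a) := by
    have hpos : (0 : ℝ) < 1 + (Δv j : ℝ) := by positivity
    rcases (hΔ j).lt_or_eq with h | h
    · have hκj : κ / (1 + (Δv j : ℝ)) ≤ (1 + (Cst j (Δv j) : ℝ)) / a := by
        rw [le_div_iff₀ ha, div_eq_mul_inv]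
        have h1 := hlower j _ h
        have h2 : κ * (1 + (Δv j : ℝ))⁻¹ ≤ κv j * (1 + (Δv j : ℝ))⁻¹ := by
          gcongr
          exact hκv j
        nlinarith
      have : X / (1 + (Δv j : ℝ)) = m / ((B : ℝ) + m) * (κ / (1 + (Δv j : ℝ))) := by
        rw [hX]
        field_simp
      rw [this]
      have := mul_le_mul_of_nonneg_left hκj (by positivity : 0 ≤ (m : ℝ) / ((B : ℝ) + m))
      linarith
    · have hXR : X ≤ R j := by
        refine le_trans ?_ (hcap j)
        rw [hX]
        gcongr
        exact hκv j
      have h1 : X / (1 + (Δv j : ℝ)) ≤ 1 := by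
        rw [div_le_one hpos, h]
        linarith
      have : 0 ≤ m / ((B : ℝ) + m) * ((1 + (Cst j (Δv j) : ℝ)) / a) := by positivity
      linarith
  have leaf_log (j : Fin m) :
      Real.logb 2 X - Real.logb 2 (1 + (Δv j : ℝ)) ≤
        (1 + m / ((B : ℝ) + m) * ((1 + (Cst j (Δv j) : ℝ)) / a)) / Real.log 2 := by
    have hpos : (0 : ℝ) < 1 + (Δv j : ℝ) := by positivity
    rw [← Real.logb_div hXpos.ne' hpos.ne', Real.logb]
    gcongr
    exact (Real.log_le_self (by positivity)).trans (leaf_ratio j)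
  have hsum := Finset.sum_le_sum fun j (_ : j ∈ Finset.univ) => leaf_log j
  rw [← Finset.sum_div, Finset.sum_add_distrib, ← Finset.mul_sum, ← Finset.sum_div,
    Finset.sum_add_distrib, Finset.sum_sub_distrib] at hsum
  simp only [Finset.sum_const, Finset.card_univ, Fintype.card_fin, nsmul_eq_mul, mul_one] at hsum
  have hbound : (m + m / ((B : ℝ) + m) * ((m + ∑ j, (Cst j (Δv j) : ℝ)) / a)) / Real.log 2 ≤
      m * ((1 / a + 1) / Real.log 2) := by
    calc _ ≤ (m + m / ((B : ℝ) + m) * ((m + (B : ℝ)) / a)) / Real.log 2 := by gcongr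
      _ = _ := by
        field_simp
        ring
  rw [← Finset.mul_sum, ← mul_le_mul_iff_right₀ hm', mul_add, ← mul_assoc,
    mul_one_div_cancel hm'.ne', one_mul]
  linarith

/-- **Hard equal-mass leaves force a non-uniform lower bound (α = 1).**
Fix `a, b > 0`.  There are constants `c > 0`, `C ≥ 0` depending only on `a, b`
such that for every instance with `m ≥ 2` equal-mass leaves (`p j = 1/m`),
exponent `α = 1`, hardnesses `κ j ≥ κ > 0`, diameters large enough that the
full-repair cap is not binding at the optimum (formalized as
`κ j · m/(B+m) ≤ R j`), and costs satisfying the `(a,b,1)`-sandwich with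
`C j (R j) = 0`, every budget-feasible radius tuple has cost at least
`c·(log₂ m + log₂⁺(κ·m/(B+m))) − C`; in particular, for every target `T`
there is a threshold `ρ₀` such that whenever `κ·m/(B+m) ≥ ρ₀` the optimal cost
exceeds `T`, so constant expected query time is impossible when
`B + m = o(κ·m)`. -/
theorem hard_equal_mass_lower_bound
    (a b : ℝ) (ha : 0 < a) (hb : 0 < b) :
    ∃ c C : ℝ, 0 < c ∧ 0 ≤ C ∧
      ((∀ (m : ℕ), 2 ≤ m → ∀ (κ : ℝ), 0 < κ →
        ∀ (κv : Fin m → ℝ), (∀ j, 0 < κv j) → (∀ j, κ ≤ κv j) →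
        ∀ (R : Fin m → ℕ) (B : ℕ) (Cst : Fin m → ℕ → ℕ),
          (∀ j, Cst j (R j) = 0) →
          (∀ (j : Fin m) (Δ : ℕ), Δ < R j →
            a * (1 + κv j * (1 + (Δ : ℝ))⁻¹) ≤ 1 + (Cst j Δ : ℝ) ∧
            1 + (Cst j Δ : ℝ) ≤ b * (1 + κv j * (1 + (Δ : ℝ))⁻¹)) →
          (∀ j, κv j * (m : ℝ) / ((B : ℝ) + m) ≤ (R j : ℝ)) →
          ∀ Δv : Fin m → ℕ, (∀ j, Δv j ≤ R j) →
            (∑ j, (Cst j (Δv j) : ℝ)) ≤ (B : ℝ) →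
            c * (Real.logb 2 (m : ℝ)
                  + max 0 (Real.logb 2 (κ * (m : ℝ) / ((B : ℝ) + m)))) - C ≤
              Real.logb 2 (m : ℝ)
                + ∑ j, (1 / (m : ℝ)) * Real.logb 2 (1 + (Δv j : ℝ))) ∧
      -- consequence: the optimal cost diverges when B + m = o(κ·m)
      (∀ T : ℝ, ∃ ρ₀ : ℝ,
        ∀ (m : ℕ), 2 ≤ m → ∀ (κ : ℝ), 0 < κ →
        ∀ (κv : Fin m → ℝ), (∀ j, 0 < κv j) → (∀ j, κ ≤ κv j) →
        ∀ (R : Fin m → ℕ) (B : ℕ) (Cst : Fin m → ℕ → ℕ),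
          (∀ j, Cst j (R j) = 0) →
          (∀ (j : Fin m) (Δ : ℕ), Δ < R j →
            a * (1 + κv j * (1 + (Δ : ℝ))⁻¹) ≤ 1 + (Cst j Δ : ℝ) ∧
            1 + (Cst j Δ : ℝ) ≤ b * (1 + κv j * (1 + (Δ : ℝ))⁻¹)) →
          (∀ j, κv j * (m : ℝ) / ((B : ℝ) + m) ≤ (R j : ℝ)) →
          ρ₀ ≤ κ * (m : ℝ) / ((B : ℝ) + m) →
          ∀ Δv : Fin m → ℕ, (∀ j, Δv j ≤ R j) →
            (∑ j, (Cst j (Δv j) : ℝ)) ≤ (B : ℝ) →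
            T ≤ Real.logb 2 (m : ℝ)
                + ∑ j, (1 / (m : ℝ)) * Real.logb 2 (1 + (Δv j : ℝ)))) := by
  have hlog : 0 < Real.log 2 := Real.log_pos (by norm_num)
  refine ⟨1, (1 / a + 1) / Real.log 2, one_pos, by positivity, ?_, ?_⟩
  · intro m hm κ hκ κv _ hκv R B Cst _ hC hcap Δv hΔ hbudget
    have key := logb_threshold_le_average_logb_radius ha (by omega) hκ hκv
      (fun j Δ h => (hC j Δ h).1) hcap hΔ hbudget
    have havg : 0 ≤ ∑ j, (1 / (m : ℝ)) * Real.logb 2 (1 + (Δv j : ℝ)) :=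
      Finset.sum_nonneg fun j _ => mul_nonneg (by positivity)
        (Real.logb_nonneg (by norm_num) (by simp))
    have hK : 0 ≤ (1 / a + 1) / Real.log 2 := by positivity
    have := max_le (add_nonneg havg hK) key
    linarith
  · intro T
    refine ⟨2 ^ (T + (1 / a + 1) / Real.log 2), ?_⟩
    intro m hm κ hκ κv _ hκv R B Cst _ hC hcap hρ Δv hΔ hbudget
    have key := logb_threshold_le_average_logb_radius ha (by omega) hκ hκv
      (fun j Δ h => (hC j Δ h).1) hcap hΔ hbudget
    have hT := Real.logb_le_logb_of_le (b := 2) (by norm_num) (by positivity) hρ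
    rw [Real.logb_rpow (by norm_num) (by norm_num)] at hT
    have hlogm : 0 ≤ Real.logb 2 (m : ℝ) :=
      Real.logb_nonneg (by norm_num) (by exact_mod_cast (by omega : 1 ≤ m))
    linarith
end
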